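/- (UnanimousVoteCutGreedyMin is unanimous and truthful for two voters and three alternatives.) Let n = 2 and m = 3, and let U be the mechanism defined via the partial cutoff c̃ and GreedyMin. Then: (i) for every v ∈ Δ², every GreedyMin aggregate of the profile (c̃(v,v), c̃(v,v)) equals v, i.e., U(v, v) = v; (ii) for all v, w, v* ∈ Δ², letting a be any GreedyMin aggregate of (c̃(v,w), c̃(w,v)) and a* any GreedyMin aggregate of (c̃(v*,w), c̃(w,v*)), it holds that ‖v − a‖₁ ≤ ‖v − a*‖₁. -/

import Mathlib

open scoped Classical BigOperators

/-- The standard simplex Δ^{m-1} as a subset of ℝ^m. -/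
def simplex (m : ℕ) : Set (Fin m → ℝ) :=
  {x | (∀ j, 0 ≤ x j) ∧ ∑ j, x j = 1}

/-- ℓ1-distance on ℝ^m. -/
noncomputable def dist1 {m : ℕ} (x y : Fin m → ℝ) : ℝ :=
  ∑ j, |x j - y j|

/-- The median of a multiset of odd cardinality: the middle element of its sorted list. -/
noncomputable def msMedian (M : Multiset ℝ) : ℝ :=
  (M.sort (· ≤ ·)).getD (M.card / 2) 0

/-- The 2n+1 element multiset {f_0(t), …, f_n(t), p_{1,j}, …, p_{n,j}}. -/
def phantomMS {n m : ℕ} (f : Fin (n + 1) → ℝ → ℝ) (P : Fin n → Fin m → ℝ)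
    (t : ℝ) (j : Fin m) : Multiset ℝ :=
  (Finset.univ.val.map fun k => f k t) + (Finset.univ.val.map fun i => P i j)

/-- The GreedyMin phantom system: f_0(t) = min(2t, 1), f_1 = … = f_n = max(0, 2t-1). -/
noncomputable def gminPhantom (n : ℕ) : Fin (n + 1) → ℝ → ℝ :=
  fun k t => if k = 0 then min (2 * t) 1 else max 0 (2 * t - 1)

/-- The GreedyMin medians med_j(t). -/
noncomputable def gminMed {n m : ℕ} (P : Fin n → Fin m → ℝ) (t : ℝ) : Fin m → ℝ :=
  fun j => msMedian (phantomMS (gminPhantom n) P t j)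

/-- t is a GreedyMin normalization time if t ∈ [0,1] and the medians sum to 1;
the associated GreedyMin aggregate is gminMed P t. -/
noncomputable def IsGminNormTime {n m : ℕ} (P : Fin n → Fin m → ℝ) (t : ℝ) : Prop :=
  t ∈ Set.Icc (0 : ℝ) 1 ∧ ∑ j, gminMed P t j = 1

/-- The partial cutoff c̃(v,w): if v has a coordinate k above 0.8 (unique on the
simplex, and the maximizing coordinate), reduce it by
γ(v,w) = (v_k - 0.8)·max(0, min((0.8 - w_k)/0.1, 1)) and redistribute γ(v,w) evenly
over the other two coordinates; otherwise c̃(v,w) = v. -/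
noncomputable def ctilde (v w : Fin 3 → ℝ) : Fin 3 → ℝ :=
  if h : ∃ k, (8 / 10 : ℝ) < v k then
    fun j =>
      if j = Classical.choose h then
        v j - (v (Classical.choose h) - 8 / 10) *
          max 0 (min ((8 / 10 - w (Classical.choose h)) / (1 / 10)) 1)
      else
        v j + (v (Classical.choose h) - 8 / 10) *
          max 0 (min ((8 / 10 - w (Classical.choose h)) / (1 / 10)) 1) / 2
  else v

theorem msMedian_eq_of_perm {l : List ℝ} {a b c d e : ℝ} (hl : l.Perm [a, b, c, d, e])
    (hab : a ≤ b) (hbc : b ≤ c) (hcd : c ≤ d) (hde : d ≤ e) :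
    msMedian (l : Multiset ℝ) = c := by
  have h : [a, b, c, d, e].Pairwise (· ≤ ·) := by
    simp only [List.pairwise_cons, List.mem_cons, List.not_mem_nil]
    grind
  have hs : (↑[a, b, c, d, e] : Multiset ℝ).sort (· ≤ ·) = [a, b, c, d, e] := by
    rw [Multiset.coe_sort]
    exact List.mergeSort_of_pairwise (by simpa using h)
  rw [Multiset.coe_eq_coe.2 hl]
  unfold msMedian
  rw [hs]
  simp

theorem msMedian_zero_zero {s p q : ℝ} (hs : 0 ≤ s) (hp : 0 ≤ p) (hq : 0 ≤ q) :
    msMedian (↑[s, 0, 0, p, q] : Multiset ℝ) = min s (min p q) := by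
  have key : ∀ x y z : ℝ, 0 ≤ x → x ≤ y → y ≤ z → [s, p, q].Perm [x, y, z] →
      msMedian (↑[s, 0, 0, p, q] : Multiset ℝ) = x := by
    intro x y z h0 h1 h2 h
    refine msMedian_eq_of_perm (a := 0) (b := 0) (d := y) (e := z) ?_ le_rfl h0 h1 h2
    rw [List.perm_iff_count] at h ⊢
    intro u
    have := h u
    simp only [List.count_cons] at this ⊢
    omega
  rcases le_total p q with h1 | h1 <;> rcases le_total s p with h2 | h2 <;>
    rcases le_total s q with h3 | h3
  all_goals first
    | (rw [key s p q] <;> grind)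
    | (rw [key s q p] <;> grind)
    | (rw [key p s q] <;> grind)
    | (rw [key q s p] <;> grind)
    | (rw [key p q s] <;> grind)
    | (rw [key q p s] <;> grind)

theorem msMedian_one {s p q : ℝ} (hs : s ≤ 1) (hp : p ≤ 1) (hq : q ≤ 1) :
    msMedian (↑[1, s, s, p, q] : Multiset ℝ) = max (min p q) s := by
  have hperm : ∀ l : List ℝ, (∀ u, List.count u [1, s, s, p, q] = List.count u l) →
      [1, s, s, p, q].Perm l := fun l => List.perm_iff_count.2
  rcases le_total p q with h1 | h1 <;> rcases le_total s p with h2 | h2 <;>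
    rcases le_total s q with h3 | h3
  all_goals first
    | (rw [msMedian_eq_of_perm (a := s) (b := s) (c := p) (d := q) (e := 1)] <;> grind)
    | (rw [msMedian_eq_of_perm (a := s) (b := s) (c := q) (d := p) (e := 1)] <;> grind)
    | (rw [msMedian_eq_of_perm (a := p) (b := s) (c := s) (d := q) (e := 1)] <;> grind)
    | (rw [msMedian_eq_of_perm (a := q) (b := s) (c := s) (d := p) (e := 1)] <;> grind)
    | (rw [msMedian_eq_of_perm (a := p) (b := q) (c := s) (d := s) (e := 1)] <;> grind)
    | (rw [msMedian_eq_of_perm (a := q) (b := p) (c := s) (d := s) (e := 1)] <;> grind)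

theorem gminMed_pair {m : ℕ} (p q : Fin m → ℝ) (t : ℝ) (j : Fin m) :
    gminMed ![p, q] t j = msMedian
      (↑[min (2 * t) 1, max 0 (2 * t - 1), max 0 (2 * t - 1), p j, q j] : Multiset ℝ) := by
  rfl

theorem le_one_of_mem_simplex {m : ℕ} {p : Fin m → ℝ} (hp : p ∈ simplex m) (j : Fin m) :
    p j ≤ 1 := by
  rw [← hp.2]
  exact Finset.single_le_sum (fun i _ => hp.1 i) (Finset.mem_univ j)

/-- For two voters, GreedyMin raises the coordinatewise minimum to a common water level. -/
theorem exists_waterLevel {m : ℕ} {p q : Fin m → ℝ} (hp : p ∈ simplex m) (hq : q ∈ simplex m)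
    {t : ℝ} (ht : IsGminNormTime ![p, q] t) :
    ∃ s, ∀ j, gminMed ![p, q] t j = max (min (p j) (q j)) s := by
  obtain ⟨⟨h0, h1⟩, hsum⟩ := ht
  rcases le_total (2 * t) 1 with h | h
  · have hmed : ∀ j, gminMed ![p, q] t j = min (2 * t) (min (p j) (q j)) := fun j => by
      rw [gminMed_pair, min_eq_left h, max_eq_left (by linarith),
        msMedian_zero_zero (by linarith) (hp.1 j) (hq.1 j)]
    have hle : ∀ j ∈ Finset.univ, gminMed ![p, q] t j ≤ p j := fun j _ => by
      rw [hmed]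
      exact (min_le_right _ _).trans (min_le_left _ _)
    have heq := (Finset.sum_eq_sum_iff_of_le hle).1 (by rw [hsum, hp.2])
    refine ⟨0, fun j => ?_⟩
    have e1 := heq j (Finset.mem_univ j)
    have e2 := hmed j
    have e3 := hp.1 j
    grind
  · refine ⟨2 * t - 1, fun j => ?_⟩
    rw [gminMed_pair, min_eq_right h, max_eq_right (by linarith),
      msMedian_one (by linarith) (le_one_of_mem_simplex hp j) (le_one_of_mem_simplex hq j)]

/-- The fraction of the excess over `0.8` that the partial cutoff removes. -/
noncomputable def ramp (x : ℝ) : ℝ :=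
  max 0 (min ((8 / 10 - x) / (1 / 10)) 1)

theorem ramp_nonneg (x : ℝ) : 0 ≤ ramp x := le_max_left _ _

theorem ramp_le_one (x : ℝ) : ramp x ≤ 1 := max_le zero_le_one (min_le_right _ _)

theorem ramp_antitone : Antitone ramp := fun x y h => by
  unfold ramp
  gcongr

theorem ramp_of_le {x : ℝ} (h : x ≤ 7 / 10) : ramp x = 1 := by
  unfold ramp
  grind

theorem ramp_of_ge {x : ℝ} (h : 8 / 10 ≤ x) : ramp x = 0 := by
  unfold ramp
  grind

theorem ramp_sub_le {x y : ℝ} (h : x ≤ y) : ramp x ≤ ramp y + 10 * (y - x) := by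
  unfold ramp
  grind

theorem Fin.exists_sum_eq_of_ne {k i : Fin 3} (h : i ≠ k) :
    ∃ j, j ≠ k ∧ i ≠ j ∧ ∀ f : Fin 3 → ℝ, ∑ l, f l = f k + f i + f j := by
  have key : ∀ k i : Fin 3, i ≠ k → ∃ j, j ≠ k ∧ i ≠ j := by decide
  obtain ⟨j, hjk, hij⟩ := key k i h
  refine ⟨j, hjk, hij, fun f => ?_⟩
  have huniv : (Finset.univ : Finset (Fin 3)) = {k, i, j} := by
    revert k i j
    decide
  rw [huniv, Finset.sum_insert (by simp [h.symm, hjk.symm]), Finset.sum_pair hij, add_assoc]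

theorem Fin.exists_sum_three (k : Fin 3) :
    ∃ i j, i ≠ k ∧ j ≠ k ∧ i ≠ j ∧ ∀ f : Fin 3 → ℝ, ∑ l, f l = f k + f i + f j := by
  obtain ⟨i, hi⟩ := exists_ne k
  obtain ⟨j, hj, hij, hsum⟩ := Fin.exists_sum_eq_of_ne hi
  exact ⟨i, j, hi, hj, hij, hsum⟩

theorem ctilde_of_le {v w : Fin 3 → ℝ} (h : ∀ k, v k ≤ 8 / 10) : ctilde v w = v :=
  dif_neg (by push Not; exact h)

theorem add_le_one_of_mem_simplex {m : ℕ} {v : Fin m → ℝ} (hv : v ∈ simplex m) {i j : Fin m}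
    (hij : i ≠ j) : v i + v j ≤ 1 := by
  rw [← hv.2, ← Finset.sum_pair hij]
  exact Finset.sum_le_sum_of_subset_of_nonneg (Finset.subset_univ _) fun l _ _ => hv.1 l

theorem ctilde_of_lt {v : Fin 3 → ℝ} (hv : v ∈ simplex 3) (w : Fin 3 → ℝ) {k : Fin 3}
    (hk : 8 / 10 < v k) :
    ctilde v w k = v k - (v k - 8 / 10) * ramp (w k) ∧
      ∀ j, j ≠ k → ctilde v w j = v j + (v k - 8 / 10) * ramp (w k) / 2 := by
  have h : ∃ k, (8 / 10 : ℝ) < v k := ⟨k, hk⟩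
  have hc : Classical.choose h = k := by
    by_contra hne
    have := add_le_one_of_mem_simplex hv hne
    have := Classical.choose_spec h
    linarith
  unfold ctilde ramp
  rw [dif_pos h, hc]
  exact ⟨if_pos rfl, fun j hj => if_neg hj⟩

theorem ctilde_mem_simplex {v : Fin 3 → ℝ} (hv : v ∈ simplex 3) (w : Fin 3 → ℝ) :
    ctilde v w ∈ simplex 3 := by
  by_cases h : ∃ k, (8 / 10 : ℝ) < v k
  · obtain ⟨k, hk⟩ := h
    obtain ⟨i, j, hi, hj, -, hsum⟩ := Fin.exists_sum_three k
    obtain ⟨h1, h2⟩ := ctilde_of_lt hv w hk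
    have hr0 := mul_nonneg (sub_nonneg.2 hk.le) (ramp_nonneg (w k))
    have hr1 := mul_le_of_le_one_right (sub_nonneg.2 hk.le) (ramp_le_one (w k))
    refine ⟨fun l => ?_, ?_⟩
    · by_cases hl : l = k
      · subst hl
        linarith
      · have := hv.1 l
        linarith [h2 l hl]
    · have := hv.2
      rw [hsum] at this ⊢
      linarith [h2 i hi, h2 j hj]
  · rwa [ctilde_of_le (by push Not at h; exact h)]

/-- The cutoff lowers a coordinate only if it stays at least `0.8`. -/
theorem le_ctilde_or {v : Fin 3 → ℝ} (hv : v ∈ simplex 3) (w : Fin 3 → ℝ) (l : Fin 3) :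
    v l ≤ ctilde v w l ∨ 8 / 10 ≤ ctilde v w l := by
  by_cases h : ∃ k, (8 / 10 : ℝ) < v k
  · obtain ⟨k, hk⟩ := h
    obtain ⟨h1, h2⟩ := ctilde_of_lt hv w hk
    have hr0 := mul_nonneg (sub_nonneg.2 hk.le) (ramp_nonneg (w k))
    have hr1 := mul_le_of_le_one_right (sub_nonneg.2 hk.le) (ramp_le_one (w k))
    by_cases hl : l = k
    · subst hl
      right
      linarith
    · left
      linarith [h2 l hl]
  · left
    rw [ctilde_of_le (by push Not at h; exact h)]

/-- The cutoff raises a coordinate only if it stays at most `0.2`. -/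
theorem ctilde_le_or {v : Fin 3 → ℝ} (hv : v ∈ simplex 3) (w : Fin 3 → ℝ) (l : Fin 3) :
    ctilde v w l ≤ v l ∨ ctilde v w l ≤ 2 / 10 := by
  by_cases h : ∃ k, (8 / 10 : ℝ) < v k
  · obtain ⟨k, hk⟩ := h
    obtain ⟨h1, h2⟩ := ctilde_of_lt hv w hk
    have hr0 := mul_nonneg (sub_nonneg.2 hk.le) (ramp_nonneg (w k))
    have hr1 := mul_le_of_le_one_right (sub_nonneg.2 hk.le) (ramp_le_one (w k))
    by_cases hl : l = k
    · subst hl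
      left
      linarith
    · right
      have := add_le_one_of_mem_simplex hv hl
      linarith [h2 l hl]
  · left
    rw [ctilde_of_le (by push Not at h; exact h)]

theorem ctilde_self {v : Fin 3 → ℝ} (hv : v ∈ simplex 3) : ctilde v v = v := by
  by_cases h : ∃ k, (8 / 10 : ℝ) < v k
  · obtain ⟨k, hk⟩ := h
    obtain ⟨h1, h2⟩ := ctilde_of_lt hv v hk
    rw [ramp_of_ge hk.le] at h1 h2
    ext l
    by_cases hl : l = k
    · subst hl
      linarith
    · linarith [h2 l hl]
  · exact ctilde_of_le (by push Not at h; exact h)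

/-- Two points of the same total mass are at distance twice the mass by which the first exceeds
the second. -/
theorem dist1_eq_two_mul {m : ℕ} {x y : Fin m → ℝ} (h : ∑ j, x j = ∑ j, y j) :
    dist1 x y = 2 * ∑ j, max 0 (x j - y j) := by
  have h1 : ∀ j, |x j - y j| = 2 * max 0 (x j - y j) - (x j - y j) := by grind
  simp only [dist1, h1, Finset.sum_sub_distrib, ← Finset.mul_sum, h]
  ring

theorem dist1_comm {m : ℕ} (x y : Fin m → ℝ) : dist1 x y = dist1 y x := by
  simp only [dist1, abs_sub_comm]

theorem gminMed_self {v : Fin 3 → ℝ} (hv : v ∈ simplex 3) {t : ℝ}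
    (ht : IsGminNormTime ![v, v] t) : gminMed ![v, v] t = v := by
  obtain ⟨s, hs⟩ := exists_waterLevel hv hv ht
  have hle : ∀ j ∈ Finset.univ, v j ≤ gminMed ![v, v] t j := fun j _ => by
    rw [hs, min_self]
    exact le_max_left _ _
  have heq := (Finset.sum_eq_sum_iff_of_le hle).1 (by rw [ht.2, hv.2])
  exact funext fun j => (heq j (Finset.mem_univ j)).symm

/-- Against an opponent `w` without a coordinate above `0.8`, no vote `p` gets closer to `v` than
the cutoff of `v` does. -/
theorem dist1_le_of_waterLevel_of_le {v w p a b : Fin 3 → ℝ} {s u : ℝ} (hv : v ∈ simplex 3)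
    (hw : ∀ j, w j ≤ 8 / 10)
    (ha : ∀ j, a j = max (min (ctilde v w j) (w j)) s) (hb : ∀ j, b j = max (min (p j) (w j)) u)
    (hasum : ∑ j, a j = 1) (hbsum : ∑ j, b j = 1) : dist1 v a ≤ dist1 v b := by
  rcases le_or_gt u s with hus | hsu
  · rw [dist1_eq_two_mul (hv.2.trans hasum.symm), dist1_eq_two_mul (hv.2.trans hbsum.symm)]
    gcongr 2 * ∑ j, ?_ with j
    have := ha j
    have := hb j
    have := hw j
    have := le_ctilde_or hv w j
    grind
  by_cases h : ∃ k, (8 / 10 : ℝ) < v k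
  · obtain ⟨k, hk⟩ := h
    obtain ⟨i, j, hi, hj, -, hsum⟩ := Fin.exists_sum_three k
    obtain ⟨h1, h2⟩ := ctilde_of_lt hv w hk
    have hr0 := mul_nonneg (sub_nonneg.2 hk.le) (ramp_nonneg (w k))
    have hr1 := mul_le_of_le_one_right (sub_nonneg.2 hk.le) (ramp_le_one (w k))
    rw [dist1_eq_two_mul (hv.2.trans hasum.symm), dist1_eq_two_mul (hv.2.trans hbsum.symm),
      hsum, hsum]
    have hvsum := hv.2
    rw [hsum] at hasum hbsum hvsum
    have h2i := h2 i hi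
    have h2j := h2 j hj
    generalize (v k - 8 / 10) * ramp (w k) = g at *
    have hak : a k = max (w k) s := by
      rw [ha, min_eq_right (by linarith [hw k])]
    have hbk : b k ≤ max (w k) u := by
      rw [hb]
      gcongr
      exact min_le_right _ _
    have hai := ha i
    have haj := ha j
    have hub : ∀ l, u ≤ b l := fun l => (le_max_right _ _).trans (hb l).ge
    have hui := hub i
    have huj := hub j
    have huk := hub k
    have hvi := hv.1 i
    have hvj := hv.1 j
    have hwk := hw k
    have hba : b k ≤ a k := by
      by_contra hlt
      have hsk : s ≤ a k := hak ▸ le_max_right _ _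
      have hwu : a k < u := by grind
      have hai' : a i ≤ 1 / 3 := by
        rw [hai]
        exact max_le ((min_le_left _ _).trans (by linarith)) (by linarith)
      have haj' : a j ≤ 1 / 3 := by
        rw [haj]
        exact max_le ((min_le_left _ _).trans (by linarith)) (by linarith)
      linarith
    have hak8 : a k ≤ 8 / 10 := by
      by_contra hlt
      have hsk : a k = s := by grind
      have : s ≤ a i := (le_max_right _ _).trans (ha i).ge
      have : s ≤ a j := (le_max_right _ _).trans (ha j).ge
      linarith
    rw [max_eq_right (show 0 ≤ v k - a k by linarith),
      max_eq_right (show 0 ≤ v k - b k by linarith)]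
    have hjs : a i < v i → a j = s := fun hlt => by
      by_contra hne
      have : a j ≤ ctilde v w j := by grind
      linarith
    have his : a j < v j → a i = s := fun hlt => by
      by_contra hne
      have : a i ≤ ctilde v w i := by grind
      linarith
    have hbi0 := le_max_left 0 (v i - b i)
    have hbj0 := le_max_left 0 (v j - b j)
    have hbi1 := le_max_right 0 (v i - b i)
    have hbj1 := le_max_right 0 (v j - b j)
    rcases le_or_gt (v i) (a i) with hvi' | hvi' <;> rcases le_or_gt (v j) (a j) with hvj' | hvj'
    · rw [max_eq_left (by linarith : v i - a i ≤ 0), max_eq_left (by linarith : v j - a j ≤ 0)]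
      linarith
    · rw [max_eq_left (by linarith : v i - a i ≤ 0), max_eq_right (by linarith : 0 ≤ v j - a j)]
      linarith [his hvj']
    · rw [max_eq_right (by linarith : 0 ≤ v i - a i), max_eq_left (by linarith : v j - a j ≤ 0)]
      linarith [hjs hvi']
    · linarith
  · rw [dist1_comm v a, dist1_comm v b, dist1_eq_two_mul (hasum.trans hv.2.symm),
      dist1_eq_two_mul (hbsum.trans hv.2.symm)]
    gcongr 2 * ∑ j, ?_ with j
    have := ha j
    have := hb j
    have := congrFun (ctilde_of_le (w := w) (by push Not at h; exact h)) j
    grind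

/-- What GreedyMin, after cutoffs, lets a voter reach against an opponent `w` with
`w k > 0.8`: coordinate `k` ranges over `[1/3, w k]`, and every other coordinate is bounded in
terms of it. -/
structure Reachable (w : Fin 3 → ℝ) (k : Fin 3) (b : Fin 3 → ℝ) : Prop where
  sum_eq : ∑ l, b l = 1
  third_le : 1 / 3 ≤ b k
  le_peak : b k ≤ w k
  le_max : ∀ l, l ≠ k →
    b l ≤ max ((1 - b k) / 2) (w l + (w k - 8 / 10) * ramp (b k) / 2)

theorem reachable_of_waterLevel {v w b : Fin 3 → ℝ} {k : Fin 3} {u : ℝ} (hv : v ∈ simplex 3)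
    (hw : w ∈ simplex 3) (hk : 8 / 10 < w k)
    (hb : ∀ j, b j = max (min (ctilde v w j) (ctilde w v j)) u) (hbsum : ∑ j, b j = 1) :
    Reachable w k b := by
  obtain ⟨h1, h2⟩ := ctilde_of_lt hw v hk
  have hr0 := mul_nonneg (sub_nonneg.2 hk.le) (ramp_nonneg (v k))
  have hr1 := mul_le_of_le_one_right (sub_nonneg.2 hk.le) (ramp_le_one (v k))
  have hub : ∀ l, u ≤ b l := fun l => (le_max_right _ _).trans (hb l).ge
  have small : ∀ l, l ≠ k → ctilde w v l ≤ 2 / 10 := fun l hl => by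
    have := add_le_one_of_mem_simplex hw hl
    linarith [h2 l hl]
  have third : 1 / 3 ≤ b k := by
    obtain ⟨i, j, hi, hj, -, hsum⟩ := Fin.exists_sum_three k
    rw [hsum] at hbsum
    by_contra hlt
    have := small i hi
    have := small j hj
    have := hb i
    have := hb j
    have := hub k
    grind
  have hu : u ≤ 1 / 3 := by
    rw [Fin.sum_univ_three] at hbsum
    linarith [hub 0, hub 1, hub 2]
  have hbk := hb k
  refine ⟨hbsum, third, by grind, fun l hl => ?_⟩
  have h2l := h2 l hl
  have hbl : b l = u ∨ b l ≤ w l + (w k - 8 / 10) * ramp (v k) / 2 := by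
    have := hb l
    grind
  rcases hbl with hbl | hbl
  · refine le_max_of_le_left ?_
    obtain ⟨j, -, -, hsum⟩ := Fin.exists_sum_eq_of_ne hl
    rw [hsum] at hbsum
    linarith [hub j]
  · refine le_max_of_le_right (hbl.trans ?_)
    have hramp : ramp (v k) ≤ ramp (b k) := by
      rcases le_or_gt (b k) (v k) with hle | hlt
      · exact ramp_antitone hle
      · rw [ramp_of_le (x := b k)]
        · exact ramp_le_one _
        · have := ctilde_le_or hv w k
          grind
    have := mul_le_mul_of_nonneg_left hramp (sub_nonneg.2 hk.le)
    linarith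

/-- Against an opponent `w` with `w k > 0.8`, a sincere vote gets the outcome that is clamped to
the boundary of the reachable region wherever it falls short of the vote. -/
theorem dist1_le_of_reachable {v w a b : Fin 3 → ℝ} {k : Fin 3} {s : ℝ} (hv : v ∈ simplex 3)
    (hw : w ∈ simplex 3) (hk : 8 / 10 < w k)
    (ha : ∀ j, a j = max (min (ctilde v w j) (ctilde w v j)) s)
    (hra : Reachable w k a) (hrb : Reachable w k b) : dist1 v a ≤ dist1 v b := by
  obtain ⟨h1, h2⟩ := ctilde_of_lt hw v hk
  have hr0 := mul_nonneg (sub_nonneg.2 hk.le) (ramp_nonneg (v k))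
  have hr1 := mul_le_of_le_one_right (sub_nonneg.2 hk.le) (ramp_le_one (v k))
  have hwk1 := le_one_of_mem_simplex hw k
  have hsa : ∀ l, s ≤ a l := fun l => (le_max_right _ _).trans (ha l).ge
  have small : ∀ l, l ≠ k → ctilde w v l ≤ 2 / 10 := fun l hl => by
    have := add_le_one_of_mem_simplex hw hl
    linarith [h2 l hl]
  have hs : s ≤ 1 / 3 := by
    have := hra.sum_eq
    rw [Fin.sum_univ_three] at this
    linarith [hsa 0, hsa 1, hsa 2]
  have hak := ha k
  have hak3 := hra.third_le
  have hge := le_ctilde_or hv w k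
  have hle := ctilde_le_or hv w k
  have uncut : 1 / 3 ≤ v k → ctilde v w = v := fun h3 => by
    by_cases hvk : 8 / 10 < v k
    · obtain ⟨e1, e2⟩ := ctilde_of_lt hv w hvk
      rw [ramp_of_ge hk.le] at e1 e2
      ext l
      by_cases hl : l = k
      · subst hl
        linarith
      · linarith [e2 l hl]
    · refine ctilde_of_le fun l => ?_
      by_cases hl : l = k
      · subst hl
        linarith
      · linarith [add_le_one_of_mem_simplex hv hl]
  have above : a k < v k → a k = w k := fun hlt => by
    have hq : ctilde w v k ≤ a k := by
      by_cases hvk : 8 / 10 < v k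
      · have := (ctilde_of_lt hv w hvk).1
        rw [ramp_of_ge hk.le] at this
        grind
      · grind
    rw [ramp_of_ge (by linarith : 8 / 10 ≤ v k)] at h1
    linarith [hra.le_peak]
  have below : v k < a k → a k = 1 / 3 := fun hlt => by grind
  have other : ∀ l, l ≠ k → a l < v l →
      max ((1 - a k) / 2) (w l + (w k - 8 / 10) * ramp (a k) / 2) ≤ a l := fun l hl hlt => by
    have hsum1 := hra.sum_eq
    have hvsum := hv.2
    obtain ⟨j, hjk, hlj, hsum⟩ := Fin.exists_sum_eq_of_ne hl
    rw [hsum] at hsum1 hvsum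
    have hq : ctilde w v l ≤ a l := by
      have := ha l
      have := le_ctilde_or hv w l
      have := small l hl
      grind
    refine max_le ?_ ?_
    · by_contra hlt2
      have haj := ha j
      have hj2 := small j hjk
      have hsl := hsa l
      rcases le_or_gt (1 / 3) (v k) with h3 | h3
      · have hcj := congrFun (uncut h3) j
        grind
      · have := below (by linarith)
        grind
    · have hramp : ramp (a k) ≤ ramp (v k) := by
        rcases le_or_gt (v k) (a k) with hle' | hlt'
        · exact ramp_antitone hle'
        · rw [above hlt', ramp_of_ge hk.le]
          exact ramp_nonneg _
      have := mul_le_mul_of_nonneg_left hramp (sub_nonneg.2 hk.le)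
      linarith [h2 l hl]
  have bound : ∀ l, l ≠ k → a l < v l → b l ≤ a l + max 0 (a k - b k) := fun l hl hlt => by
    refine (hrb.le_max l hl).trans (max_le ?_ ?_)
    · have := (le_max_left _ _).trans (other l hl hlt)
      have := le_max_left 0 (a k - b k)
      have := le_max_right 0 (a k - b k)
      linarith
    · have hal := (le_max_right _ _).trans (other l hl hlt)
      have hramp : ramp (b k) ≤ ramp (a k) + 10 * max 0 (a k - b k) := by
        rcases le_total (a k) (b k) with hab | hab
        · rw [max_eq_left (by linarith)]
          linarith [ramp_antitone hab]
        · rw [max_eq_right (by linarith)]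
          exact ramp_sub_le hab
      have := mul_le_mul_of_nonneg_left hramp (sub_nonneg.2 hk.le)
      have : (w k - 8 / 10) * max 0 (a k - b k) ≤ 2 / 10 * max 0 (a k - b k) := by
        gcongr
        linarith
      linarith
  obtain ⟨i, j, hi, hj, -, hsum⟩ := Fin.exists_sum_three k
  rw [dist1_eq_two_mul (hv.2.trans hra.sum_eq.symm), dist1_eq_two_mul (hv.2.trans hrb.sum_eq.symm),
    hsum, hsum]
  have hvsum := hv.2
  have hasum := hra.sum_eq
  have hbsum := hrb.sum_eq
  rw [hsum] at hvsum hasum hbsum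
  have hbi := bound i hi
  have hbj := bound j hj
  have hoi := fun h => (le_max_left _ _).trans (other i hi h)
  have hoj := fun h => (le_max_left _ _).trans (other j hj h)
  have hbk3 := hrb.third_le
  have hbkw := hrb.le_peak
  clear bound other hsum hge hle hak h1 h2 hr0 hr1 small hsa ha uncut hra hrb
  rcases le_or_gt (v i) (a i) with hvi | hvi <;> rcases le_or_gt (v j) (a j) with hvj | hvj
  · grind
  · have := hbj hvj
    grind
  · have := hbi hvi
    grind
  · have := hbi hvi
    have := hbj hvj
    have := hoi hvi
    have := hoj hvj
    have := below (by linarith)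
    grind

/-- UnanimousVoteCutGreedyMin (apply the partial cutoff c̃ to each of
the two votes with respect to the other, then run GreedyMin) is unanimous and
truthful for two voters and three alternatives. -/
theorem stmt18 :
    (∀ v : Fin 3 → ℝ, v ∈ simplex 3 →
      ∀ t : ℝ, IsGminNormTime ![ctilde v v, ctilde v v] t →
        gminMed ![ctilde v v, ctilde v v] t = v) ∧
    (∀ v w vs : Fin 3 → ℝ, v ∈ simplex 3 → w ∈ simplex 3 → vs ∈ simplex 3 →
      ∀ t ts : ℝ,
        IsGminNormTime ![ctilde v w, ctilde w v] t →
        IsGminNormTime ![ctilde vs w, ctilde w vs] ts →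
        dist1 v (gminMed ![ctilde v w, ctilde w v] t) ≤
          dist1 v (gminMed ![ctilde vs w, ctilde w vs] ts)) := by
  refine ⟨fun v hv t ht => ?_, fun v w vs hv hw hvs t ts ht hts => ?_⟩
  · rw [ctilde_self hv] at ht ⊢
    exact gminMed_self hv ht
  · obtain ⟨s, hs⟩ := exists_waterLevel (ctilde_mem_simplex hv w) (ctilde_mem_simplex hw v) ht
    obtain ⟨u, hu⟩ := exists_waterLevel (ctilde_mem_simplex hvs w) (ctilde_mem_simplex hw vs) hts
    by_cases h : ∃ k, (8 / 10 : ℝ) < w k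
    · obtain ⟨k, hk⟩ := h
      exact dist1_le_of_reachable hv hw hk hs (reachable_of_waterLevel hv hw hk hs ht.2)
        (reachable_of_waterLevel hvs hw hk hu hts.2)
    · push Not at h
      refine dist1_le_of_waterLevel_of_le (p := ctilde vs w) (s := s) (u := u) hv h
        (fun j => ?_) (fun j => ?_) ht.2 hts.2
      · rw [hs, ctilde_of_le h]
      · rw [hu, ctilde_of_le h]
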